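/- Let K be a convex body in ℝ² with centroid at the origin and int(K) ∩ ℤ² = {0}, and suppose the origin is not an interior point of P = conv(K ∩ ℤ²). Then #(K ∩ ℤ²) ≤ 7. -/

import Mathlib

open MeasureTheory Set Pointwise

/-- The set of integer lattice points of `ℝ²`. -/
def latticePts2 : Set (Fin 2 → ℝ) := {x | ∀ i, ∃ z : ℤ, x i = (z : ℝ)}


lemma exists_coprime_dir (d1 d2 : ℤ) (h : ¬ (d1 = 0 ∧ d2 = 0)) :
    ∃ g u1 u2 s t : ℤ, 0 < g ∧ d1 = g * u1 ∧ d2 = g * u2 ∧ s * u1 + t * u2 = 1 := by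
  have hg : 0 < Int.gcd d1 d2 := by
    rw [Nat.pos_iff_ne_zero]; intro h0; exact h (Int.gcd_eq_zero_iff.mp h0)
  obtain ⟨m, n, h1, h2, h3⟩ := Int.exists_gcd_one hg
  obtain ⟨s, t, hst⟩ := Int.isCoprime_iff_gcd_eq_one.mpr h1
  exact ⟨Int.gcd d1 d2, m, n, s, t, by exact_mod_cast hg, by rw [mul_comm]; exact h2,
    by rw [mul_comm]; exact h3, hst⟩

lemma bary (p1 p2 q1 q2 r1 r2 x1 x2 : ℝ)
    (hD : (q1 - p1) * (r2 - p2) - (q2 - p2) * (r1 - p1) ≠ 0) :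
    ∃ α β γ : ℝ, α + β + γ = 1 ∧ x1 = α * p1 + β * q1 + γ * r1 ∧
      x2 = α * p2 + β * q2 + γ * r2 := by
  refine ⟨((q1 - x1) * (r2 - x2) - (q2 - x2) * (r1 - x1)) /
      ((q1 - p1) * (r2 - p2) - (q2 - p2) * (r1 - p1)),
    ((r1 - x1) * (p2 - x2) - (r2 - x2) * (p1 - x1)) /
      ((q1 - p1) * (r2 - p2) - (q2 - p2) * (r1 - p1)),
    ((p1 - x1) * (q2 - x2) - (p2 - x2) * (q1 - x1)) /
      ((q1 - p1) * (r2 - p2) - (q2 - p2) * (r1 - p1)), ?_, ?_, ?_⟩ <;> field_simp <;> ring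

lemma func_zero (a b p1 p2 q1 q2 r1 r2 : ℝ)
    (hD : (q1 - p1) * (r2 - p2) - (q2 - p2) * (r1 - p1) ≠ 0)
    (h1 : a * q1 + b * q2 = a * p1 + b * p2) (h2 : a * r1 + b * r2 = a * p1 + b * p2) :
    a = 0 ∧ b = 0 := by
  constructor
  · have : a * ((q1 - p1) * (r2 - p2) - (q2 - p2) * (r1 - p1)) = 0 := by
      linear_combination (r2 - p2) * h1 - (q2 - p2) * h2
    exact (mul_eq_zero.mp this).resolve_right hD
  · have : b * ((q1 - p1) * (r2 - p2) - (q2 - p2) * (r1 - p1)) = 0 := by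
      linear_combination (q1 - p1) * h2 - (r1 - p1) * h1
    exact (mul_eq_zero.mp this).resolve_right hD

def DetNZ (p q r : ℤ × ℤ) : Prop :=
  ((q.1 : ℝ) - p.1) * (r.2 - p.2) - (q.2 - p.2) * (r.1 - p.1) ≠ 0

def Supp (S : Finset (ℤ × ℤ)) : Prop :=
  ∀ z ∈ S, ∃ a b : ℝ, ¬ (a = 0 ∧ b = 0) ∧
    ∀ x ∈ S, a * x.1 + b * x.2 ≤ a * z.1 + b * z.2

def NoFour (S : Finset (ℤ × ℤ)) : Prop :=
  ∀ p ∈ S, ∀ q ∈ S, ∀ (k u1 u2 : ℤ), 4 ≤ k → p.1 - q.1 = k * u1 → p.2 - q.2 = k * u2 →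
    u1 = 0 ∧ u2 = 0

lemma coef_nonneg {S : Finset (ℤ × ℤ)} (hS : Supp S) {p q r m x : ℤ × ℤ}
    (hp : p ∈ S) (hq : q ∈ S) (hr : r ∈ S) (hm : m ∈ S) (hx : x ∈ S)
    (h1 : p.1 + q.1 = 2 * m.1) (h2 : p.2 + q.2 = 2 * m.2) (hD : DetNZ p q r)
    {α β γ : ℝ} (hs : α + β + γ = 1) (hx1 : (x.1 : ℝ) = α * p.1 + β * q.1 + γ * r.1)
    (hx2 : (x.2 : ℝ) = α * p.2 + β * q.2 + γ * r.2) : 0 ≤ γ := by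
  by_contra hγ
  push Not at hγ
  obtain ⟨a, b, hab, H⟩ := hS m hm
  have e1 : (p.1 : ℝ) + q.1 = 2 * m.1 := by exact_mod_cast h1
  have e2 : (p.2 : ℝ) + q.2 = 2 * m.2 := by exact_mod_cast h2
  have Hp := H p hp
  have Hq := H q hq
  have Hr := H r hr
  have Hx := H x hx
  have es : (a * p.1 + b * p.2) + (a * q.1 + b * q.2) = 2 * (a * m.1 + b * m.2) := by
    linear_combination a * e1 + b * e2
  have fp : a * p.1 + b * p.2 = a * m.1 + b * m.2 := by linarith
  have fq : a * q.1 + b * q.2 = a * m.1 + b * m.2 := by linarith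
  have fx : a * x.1 + b * x.2 - (a * m.1 + b * m.2)
      = γ * (a * r.1 + b * r.2 - (a * m.1 + b * m.2)) := by
    rw [hx1, hx2]
    linear_combination α * fp + β * fq + (a * m.1 + b * m.2) * hs
  have fr : a * r.1 + b * r.2 = a * m.1 + b * m.2 := by
    nlinarith
  exact hab (func_zero a b _ _ _ _ _ _ hD (by linarith) (by linarith))

lemma not_all_pos {S : Finset (ℤ × ℤ)} (hS : Supp S) {p q r x : ℤ × ℤ}
    (hp : p ∈ S) (hq : q ∈ S) (hr : r ∈ S) (hx : x ∈ S) (hD : DetNZ p q r)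
    {α β γ : ℝ} (hs : α + β + γ = 1) (hx1 : (x.1 : ℝ) = α * p.1 + β * q.1 + γ * r.1)
    (hx2 : (x.2 : ℝ) = α * p.2 + β * q.2 + γ * r.2) (h1 : 0 < α) (h2 : 0 < β) (h3 : 0 < γ) :
    False := by
  obtain ⟨a, b, hab, H⟩ := hS x hx
  have Hp := H p hp
  have Hq := H q hq
  have Hr := H r hr
  have e : α * ((a * x.1 + b * x.2) - (a * p.1 + b * p.2)) +
     β * ((a * x.1 + b * x.2) - (a * q.1 + b * q.2)) +
     γ * ((a * x.1 + b * x.2) - (a * r.1 + b * r.2)) = 0 := by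
    linear_combination (a * x.1 + b * x.2) * hs + a * hx1 + b * hx2
  have n1 := mul_nonneg h1.le (sub_nonneg.mpr Hp)
  have n2 := mul_nonneg h2.le (sub_nonneg.mpr Hq)
  have n3 := mul_nonneg h3.le (sub_nonneg.mpr Hr)
  have z1 := (mul_eq_zero.mp (by linarith : α * ((a * x.1 + b * x.2) - (a * p.1 + b * p.2)) = 0)).resolve_left h1.ne'
  have z2 := (mul_eq_zero.mp (by linarith : β * ((a * x.1 + b * x.2) - (a * q.1 + b * q.2)) = 0)).resolve_left h2.ne'
  have z3 := (mul_eq_zero.mp (by linarith : γ * ((a * x.1 + b * x.2) - (a * r.1 + b * r.2)) = 0)).resolve_left h3.ne'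
  exact hab (func_zero a b _ _ _ _ _ _ hD (by linarith) (by linarith))

lemma edge {S : Finset (ℤ × ℤ)} (hN : NoFour S) {p q m x : ℤ × ℤ}
    (hp : p ∈ S) (hq : q ∈ S)
    (h1 : p.1 + q.1 = 2 * m.1) (h2 : p.2 + q.2 = 2 * m.2) (hne : p ≠ q)
    {α β : ℝ} (hα : 0 ≤ α) (hβ : 0 ≤ β) (hs : α + β = 1)
    (hx1 : (x.1 : ℝ) = α * p.1 + β * q.1)
    (hx2 : (x.2 : ℝ) = α * p.2 + β * q.2) : x = p ∨ x = q ∨ x = m := by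
  have hd : ¬ (m.1 - q.1 = 0 ∧ m.2 - q.2 = 0) := by
    rintro ⟨a, b⟩; apply hne; ext <;> omega
  obtain ⟨g, u1, u2, s, t, hg, hu1, hu2, hst⟩ := exists_coprime_dir _ _ hd
  have hg1 : g = 1 := by
    by_contra hg1
    obtain ⟨z1, z2⟩ := hN p hp q hq (2 * g) u1 u2 (by omega) (by linarith) (by linarith)
    rw [z1, z2] at hst; simp at hst
  subst hg1
  have hb : β = 1 - α := by linarith
  have c1 : (p.1 : ℝ) + q.1 = 2 * m.1 := by exact_mod_cast h1
  have c2 : (p.2 : ℝ) + q.2 = 2 * m.2 := by exact_mod_cast h2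
  have d1 : (m.1 : ℝ) - q.1 = 1 * u1 := by exact_mod_cast hu1
  have d2 : (m.2 : ℝ) - q.2 = 1 * u2 := by exact_mod_cast hu2
  have dst : (s : ℝ) * u1 + t * u2 = 1 := by exact_mod_cast hst
  have k1 : (x.1 : ℝ) - q.1 = 2 * α * u1 := by
    rw [hx1, hb]; linear_combination α * c1 + 2 * α * d1
  have k2 : (x.2 : ℝ) - q.2 = 2 * α * u2 := by
    rw [hx2, hb]; linear_combination α * c2 + 2 * α * d2
  have hk : 2 * α = ((s * (x.1 - q.1) + t * (x.2 - q.2) : ℤ) : ℝ) := by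
    push_cast; rw [k1, k2]; linear_combination (- 2 * α) * dst
  set k : ℤ := s * (x.1 - q.1) + t * (x.2 - q.2)
  have k0 : 0 ≤ k := by
    have : (0 : ℝ) ≤ k := by linarith
    exact_mod_cast this
  have k2' : k ≤ 2 := by
    have : (k : ℝ) ≤ 2 := by linarith
    exact_mod_cast this
  rw [hk] at k1 k2
  have i1 : x.1 - q.1 = k * u1 := by exact_mod_cast k1
  have i2 : x.2 - q.2 = k * u2 := by exact_mod_cast k2
  interval_cases k
  · right; left; ext <;> linarith
  · right; right; ext <;> linarith
  · left; ext <;> linarith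

lemma comb (S : Finset (ℤ × ℤ))
    (hA : ∀ p ∈ S, ∀ q ∈ S, ∀ r ∈ S, DetNZ p q r → Supp S)
    (hB : ∀ p ∈ S, ∀ q ∈ S, ∀ m : ℤ × ℤ, p.1 + q.1 = 2 * m.1 → p.2 + q.2 = 2 * m.2 → m ∈ S)
    (hN : NoFour S)
    (hE : ∀ p ∈ S, ∀ m : ℤ × ℤ, p.1 = 2 * m.1 → p.2 = 2 * m.2 → p = 0) :
    S.card ≤ 7 := by
  by_contra hc
  push Not at hc
  obtain ⟨c, -, hc3⟩ : ∃ c ∈ (Finset.univ.erase (0 : ZMod 2 × ZMod 2)),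
      2 < ((S.erase 0).filter (fun v => ((v.1 : ZMod 2), (v.2 : ZMod 2)) = c)).card := by
    apply Finset.exists_lt_card_fiber_of_mul_lt_card_of_maps_to
    · intro v hv
      rw [Finset.mem_erase] at hv
      simp only [Finset.mem_erase, Finset.mem_univ, and_true]
      intro h0
      rw [Prod.mk_eq_zero] at h0
      have h1 := (ZMod.intCast_zmod_eq_zero_iff_dvd v.1 2).mp h0.1
      have h2 := (ZMod.intCast_zmod_eq_zero_iff_dvd v.2 2).mp h0.2
      obtain ⟨a, ha⟩ := h1
      obtain ⟨b, hb⟩ := h2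
      exact hv.1 (hE v hv.2 (a, b) (by simpa using ha) (by simpa using hb))
    · have h1 : (Finset.univ.erase (0 : ZMod 2 × ZMod 2)).card = 3 := by decide
      have := Finset.pred_card_le_card_erase (s := S) (a := (0 : ℤ × ℤ))
      rw [h1]; omega
  obtain ⟨p, hp, q, hq, r, hr, hpq, hpr, hqr⟩ := Finset.two_lt_card.mp hc3
  simp only [Finset.mem_filter, Finset.mem_erase] at hp hq hr
  have mid : ∀ x y : ℤ × ℤ, x ∈ S → y ∈ S → ((x.1 : ZMod 2), (x.2 : ZMod 2)) = c →
      ((y.1 : ZMod 2), (y.2 : ZMod 2)) = c →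
      ∃ m ∈ S, x.1 + y.1 = 2 * m.1 ∧ x.2 + y.2 = 2 * m.2 := by
    intro x y hx hy hxc hyc
    rw [← hyc, Prod.mk.injEq] at hxc
    have h1 := (ZMod.intCast_eq_intCast_iff_dvd_sub _ _ _).mp hxc.1
    have h2 := (ZMod.intCast_eq_intCast_iff_dvd_sub _ _ _).mp hxc.2
    have e1 : x.1 + y.1 = 2 * ((x.1 + y.1) / 2) := by push_cast at h1; omega
    have e2 : x.2 + y.2 = 2 * ((x.2 + y.2) / 2) := by push_cast at h2; omega
    exact ⟨((x.1 + y.1) / 2, (x.2 + y.2) / 2), hB x hx y hy _ e1 e2, e1, e2⟩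
  obtain ⟨mpq, hmpq, e1, e2⟩ := mid p q hp.1.2 hq.1.2 hp.2 hq.2
  obtain ⟨mpr, hmpr, e3, e4⟩ := mid p r hp.1.2 hr.1.2 hp.2 hr.2
  obtain ⟨mqr, hmqr, e5, e6⟩ := mid q r hq.1.2 hr.1.2 hq.2 hr.2
  have hD : DetNZ p q r := by
    intro h0
    have h0' : (q.1 - p.1) * (r.2 - p.2) - (q.2 - p.2) * (r.1 - p.1) = 0 := by exact_mod_cast h0
    obtain ⟨g, u1, u2, s, t, hg, hu1, hu2, hst⟩ := exists_coprime_dir (mpq.1 - p.1) (mpq.2 - p.2)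
      (by rintro ⟨a, b⟩; apply hpq; ext <;> omega)
    have a1 : q.1 - p.1 = 2 * g * u1 := by linarith
    have a2 : q.2 - p.2 = 2 * g * u2 := by linarith
    have hcr : u1 * (mpr.2 - p.2) - u2 * (mpr.1 - p.1) = 0 := by
      have : (4 * g) * (u1 * (mpr.2 - p.2) - u2 * (mpr.1 - p.1)) = 0 := by
        have b1 : r.1 - p.1 = 2 * (mpr.1 - p.1) := by linarith
        have b2 : r.2 - p.2 = 2 * (mpr.2 - p.2) := by linarith
        rw [a1, a2, b1, b2] at h0'
        linear_combination h0'
      exact (mul_eq_zero.mp this).resolve_left (by omega)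
    obtain ⟨j, hj⟩ : ∃ j : ℤ, j = s * (mpr.1 - p.1) + t * (mpr.2 - p.2) := ⟨_, rfl⟩
    have b1 : mpr.1 - p.1 = j * u1 := by
      rw [hj]; linear_combination (- (mpr.1 - p.1)) * hst - t * hcr
    have b2 : mpr.2 - p.2 = j * u2 := by
      rw [hj]; linear_combination (- (mpr.2 - p.2)) * hst + s * hcr
    have c1 : r.1 - p.1 = 2 * j * u1 := by linarith
    have c2 : r.2 - p.2 = 2 * j * u2 := by linarith
    have hu : ¬ (u1 = 0 ∧ u2 = 0) := by
      rintro ⟨z1, z2⟩; rw [z1, z2] at hst; simp at hst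
    have n1 : ¬ 4 ≤ 2 * g := fun h => hu (hN q hq.1.2 p hp.1.2 _ _ _ h a1 a2)
    have n2 : ¬ 4 ≤ 2 * j := fun h => hu (hN r hr.1.2 p hp.1.2 _ _ _ h c1 c2)
    have n3 : ¬ 4 ≤ 2 * g - 2 * j := fun h => hu (hN q hq.1.2 r hr.1.2 _ _ _ h
      (by linear_combination a1 - c1) (by linear_combination a2 - c2))
    have j0 : j ≠ 0 := by
      rintro rfl; apply hpr; ext <;> linarith
    have jg : j ≠ g := by
      rintro rfl; apply hqr; ext <;> linarith
    omega
  have hS := hA p hp.1.2 q hq.1.2 r hr.1.2 hD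
  have hD2 : DetNZ p r q := by
    intro h; apply hD; linear_combination -h
  have hD3 : DetNZ q r p := by
    intro h; apply hD; linear_combination h
  have hsub : S ⊆ {p, q, r, mpq, mpr, mqr} := by
    intro x hx
    obtain ⟨α, β, γ, hs, hx1, hx2⟩ := bary (p.1 : ℝ) p.2 q.1 q.2 r.1 r.2 x.1 x.2 hD
    have hγ := coef_nonneg hS hp.1.2 hq.1.2 hr.1.2 hmpq hx e1 e2 hD hs hx1 hx2
    have hβ := coef_nonneg hS hp.1.2 hr.1.2 hq.1.2 hmpr hx e3 e4 hD2
      (α := α) (β := γ) (γ := β) (by linarith) (by linarith) (by linarith)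
    have hα := coef_nonneg hS hq.1.2 hr.1.2 hp.1.2 hmqr hx e5 e6 hD3
      (α := β) (β := γ) (γ := α) (by linarith) (by linarith) (by linarith)
    simp only [Finset.mem_insert, Finset.mem_singleton]
    rcases hα.eq_or_lt with h | h1
    · subst h
      have := edge (x := x) hN hq.1.2 hr.1.2 e5 e6 hqr hβ hγ (by linarith) (by linarith) (by linarith)
      tauto
    rcases hβ.eq_or_lt with h | h2
    · subst h
      have := edge (x := x) hN hp.1.2 hr.1.2 e3 e4 hpr hα hγ (by linarith) (by linarith) (by linarith)
      tauto
    rcases hγ.eq_or_lt with h | h3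
    · subst h
      have := edge (x := x) hN hp.1.2 hq.1.2 e1 e2 hpq hα hβ (by linarith) (by linarith) (by linarith)
      tauto
    exact (not_all_pos hS hp.1.2 hq.1.2 hr.1.2 hx hD hs hx1 hx2 h1 h2 h3).elim
  have := (Finset.card_le_card hsub).trans Finset.card_le_six
  omega

abbrev E2 := Fin 2 → ℝ

lemma scale_bound (L : Set E2) (hL : IsCompact L) (hc : Convex ℝ L) (h0 : (0 : E2) ∈ L)
    (f : E2 →L[ℝ] ℝ) (M : ℝ) (hM : ∀ y ∈ L, f y ≤ M) :
    3 * ∫ y in L, f y ≤ 2 * M * volume.real L := by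
  have hint : IntegrableOn (fun y => f y) L := f.continuous.continuousOn.integrableOn_compact hL
  have key : ∀ s : ℝ, 0 < s → s < 1 →
      (1 + s + s ^ 2) * ∫ y in L, f y ≤ (1 + s) * M * volume.real L := by
    intro s hs hs1
    have hsub : s • L ⊆ L := by
      rintro _ ⟨y, hy, rfl⟩
      exact hc.smul_mem_of_zero_mem h0 hy ⟨hs.le, hs1.le⟩
    have hcs : IsCompact (s • L) := hL.smul s
    have hI : ∫ y in s • L, f y = s ^ 3 * ∫ y in L, f y := by
      have h := Measure.setIntegral_comp_smul (volume : Measure E2) (fun y => f y) (R := s) L hs.ne'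
      simp only [map_smul, smul_eq_mul, integral_const_mul] at h
      rw [abs_of_pos (by positivity)] at h
      simp only [Module.finrank_fintype_fun_eq_card, Fintype.card_fin] at h
      field_simp at h
      linarith
    have hV : volume.real (s • L) = s ^ 2 * volume.real L := by
      rw [Measure.real, Measure.addHaar_smul, ENNReal.toReal_mul,
        ENNReal.toReal_ofReal (abs_nonneg _), abs_of_pos (by positivity)]
      simp [Measure.real]
    have h1 : ∫ y in L \ s • L, f y = (∫ y in L, f y) - ∫ y in s • L, f y :=
      setIntegral_sdiff hcs.measurableSet hint hsub
    have h2 : ∫ y in L \ s • L, f y ≤ ∫ y in L \ s • L, M := by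
      apply setIntegral_mono_on (hint.mono_set sdiff_subset) _
        (hL.measurableSet.diff hcs.measurableSet) (fun y hy => hM y hy.1)
      exact integrableOn_const ((measure_mono sdiff_subset).trans_lt hL.measure_lt_top).ne
    rw [setIntegral_const, h1, hI, measureReal_sdiff hsub hcs.measurableSet hL.measure_lt_top.ne, hV,
      smul_eq_mul] at h2
    have : (1 - s) * ((1 + s + s ^ 2) * ∫ y in L, f y) ≤ (1 - s) * ((1 + s) * M * volume.real L) := by
      linarith
    exact le_of_mul_le_mul_left this (by linarith)
  have c1 : Filter.Tendsto (fun s : ℝ => (1 + s + s ^ 2) * ∫ y in L, f y) (nhdsWithin 1 (Iio 1))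
      (nhds ((1 + 1 + 1 ^ 2) * ∫ y in L, f y)) := by
    apply Filter.Tendsto.mono_left _ nhdsWithin_le_nhds
    apply Continuous.tendsto (by fun_prop)
  have c2 : Filter.Tendsto (fun s : ℝ => (1 + s) * M * volume.real L) (nhdsWithin 1 (Iio 1))
      (nhds ((1 + 1) * M * volume.real L)) := by
    apply Filter.Tendsto.mono_left _ nhdsWithin_le_nhds
    apply Continuous.tendsto (by fun_prop)
  have := le_of_tendsto_of_tendsto c1 c2 (by
    filter_upwards [Ioo_mem_nhdsLT (show (0 : ℝ) < 1 by norm_num)] with s hs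
    exact key s hs.1 hs.2)
  linarith

lemma neg_half (K : Set E2)
    (hKcpt : IsCompact K) (hKconv : Convex ℝ K) (hKint : (interior K).Nonempty)
    (hcent : (⨍ x in K, x) = (0 : E2)) {x : E2} (hx : x ∈ K) : -(1 / 2 : ℝ) • x ∈ K := by
  by_contra hn
  obtain ⟨f, u, hf, hu⟩ := geometric_hahn_banach_closed_point hKconv hKcpt.isClosed hn
  have hpos : 0 < volume.real K := by
    rw [Measure.real, ENNReal.toReal_pos_iff]
    exact ⟨Measure.measure_pos_of_nonempty_interior _ hKint, hKcpt.measure_lt_top⟩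
  have hcent' : ∫ y in K, y = (0 : E2) := by
    rw [setAverage_eq, smul_eq_zero] at hcent
    exact hcent.resolve_left (inv_ne_zero hpos.ne')
  have hfi : ∫ y in K, f y = 0 := by
    rw [ContinuousLinearMap.integral_comp_comm f (φ := fun y => y)
      (continuousOn_id.integrableOn_compact hKcpt), hcent', map_zero]
  let e : E2 → E2 := fun y => y + x
  have hmp : MeasurePreserving e volume volume := measurePreserving_add_right volume x
  have hem : MeasurableEmbedding e := (Homeomorph.addRight x).measurableEmbedding
  have hLc : IsCompact (e ⁻¹' K) := (Homeomorph.addRight x).isCompact_preimage.mpr hKcpt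
  have hLconv : Convex ℝ (e ⁻¹' K) := hKconv.translate_preimage_left x
  have hb := scale_bound (e ⁻¹' K) hLc hLconv (by simpa [e] using hx) f (u - f x) (by
    intro y hy
    have := hf _ hy
    simp only [e, map_add] at this
    linarith)
  have hV : volume.real (e ⁻¹' K) = volume.real K := by
    rw [Measure.real, hmp.measure_preimage hKcpt.measurableSet.nullMeasurableSet, Measure.real]
  have hI : ∫ y in e ⁻¹' K, f y = - f x * volume.real K := by
    have := hmp.setIntegral_preimage_emb hem (fun y => f y - f x) K
    simp only [e, map_add, add_sub_cancel_right] at this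
    rw [this, integral_sub (f.continuous.continuousOn.integrableOn_compact hKcpt)
      (integrableOn_const hKcpt.measure_lt_top.ne), hfi, setIntegral_const, smul_eq_mul]
    ring
  rw [hV, hI] at hb
  rw [map_smul, smul_eq_mul] at hu
  nlinarith

lemma supp_of_not_interior (C : Set E2) (hC : Convex ℝ C) (hne : (interior C).Nonempty)
    {z : E2} (hz : z ∉ interior C) :
    ∃ a b : ℝ, ¬ (a = 0 ∧ b = 0) ∧ ∀ x ∈ C, a * x 0 + b * x 1 ≤ a * z 0 + b * z 1 := by
  obtain ⟨f, hf⟩ := geometric_hahn_banach_open_point hC.interior isOpen_interior hz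
  have hfe : ∀ x : E2, f x = f (Pi.single 0 1) * x 0 + f (Pi.single 1 1) * x 1 := by
    intro x
    have : x = x 0 • (Pi.single 0 1 : E2) + x 1 • (Pi.single 1 1 : E2) := by
      ext i; fin_cases i <;> simp
    conv_lhs => rw [this]
    rw [map_add, map_smul, map_smul, smul_eq_mul, smul_eq_mul]; ring
  refine ⟨f (Pi.single 0 1), f (Pi.single 1 1), ?_, ?_⟩
  · rintro ⟨h1, h2⟩
    obtain ⟨y, hy⟩ := hne
    have := hf y hy
    rw [hfe y, hfe z, h1, h2] at this
    simp at this
  · intro x hx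
    rw [← hfe, ← hfe]
    have hx' : x ∈ closure (interior C) := by
      rw [hC.closure_interior_eq_closure_of_nonempty_interior hne]; exact subset_closure hx
    have : closure (interior C) ⊆ {y | f y ≤ f z} :=
      closure_minimal (fun y hy => (hf y hy).le) (isClosed_le f.continuous continuous_const)
    exact this hx'
def emb (z : ℤ × ℤ) : E2 := ![(z.1 : ℝ), (z.2 : ℝ)]

lemma emb_inj : Function.Injective emb := by
  intro a b h
  have h0 := congrFun h 0
  have h1 := congrFun h 1
  simp [emb] at h0 h1
  exact Prod.ext h0 h1

lemma emb_mem (z : ℤ × ℤ) : emb z ∈ latticePts2 := by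
  intro i
  fin_cases i
  · exact ⟨z.1, by simp [emb]⟩
  · exact ⟨z.2, by simp [emb]⟩

lemma exists_emb {x : E2} (hx : x ∈ latticePts2) : ∃ z, emb z = x := by
  obtain ⟨a, ha⟩ := hx 0
  obtain ⟨b, hb⟩ := hx 1
  refine ⟨(a, b), ?_⟩
  ext i; fin_cases i <;> simp [emb, ha, hb]

lemma hull_interior {A : Set E2} {p q r : ℤ × ℤ} (hp : emb p ∈ A) (hq : emb q ∈ A)
    (hr : emb r ∈ A) (hD : DetNZ p q r) : (interior (convexHull ℝ A)).Nonempty := by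
  rw [interior_convexHull_nonempty_iff_affineSpan_eq_top]
  rw [eq_top_iff]
  intro x _
  obtain ⟨α, β, γ, hs, h1, h2⟩ := bary (p.1 : ℝ) p.2 q.1 q.2 r.1 r.2 (x 0) (x 1) hD
  have mp := mem_affineSpan ℝ hp
  have mq := mem_affineSpan ℝ hq
  have mr := mem_affineSpan ℝ hr
  have d := Submodule.add_mem _
    (Submodule.smul_mem _ β (AffineSubspace.vsub_mem_direction mq mp))
    (Submodule.smul_mem _ γ (AffineSubspace.vsub_mem_direction mr mp))
  have := AffineSubspace.vadd_mem_of_mem_direction d mp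
  convert this using 1
  have hα : α = 1 - β - γ := by linarith
  ext i; fin_cases i
  · simp [emb, h1, hα]; ring
  · simp [emb, h2, hα]; ring

theorem planar_bound_origin_not_interior (K : Set (Fin 2 → ℝ))
    (hKcpt : IsCompact K) (hKconv : Convex ℝ K) (hKint : (interior K).Nonempty)
    (hcent : (⨍ x in K, x) = (0 : Fin 2 → ℝ))
    (honly : interior K ∩ latticePts2 = {0})
    (hP : (0 : Fin 2 → ℝ) ∉ interior (convexHull ℝ (K ∩ latticePts2))) :
    Set.ncard (K ∩ latticePts2) ≤ 7 := by
  have himg : K ∩ latticePts2 = emb '' (emb ⁻¹' K) := by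
    ext x; constructor
    · rintro ⟨hx, hl⟩
      obtain ⟨z, rfl⟩ := exists_emb hl
      exact ⟨z, hx, rfl⟩
    · rintro ⟨z, hz, rfl⟩
      exact ⟨hz, emb_mem z⟩
  have h0 : (0 : E2) ∈ interior K := by
    have : (0 : E2) ∈ interior K ∩ latticePts2 := by rw [honly]; rfl
    exact this.1
  have hz0 : ∀ z, emb z ∈ interior K → z = 0 := by
    intro z hz
    have : emb z ∈ interior K ∩ latticePts2 := ⟨hz, emb_mem z⟩
    rw [honly, mem_singleton_iff] at this
    apply emb_inj; rw [this]; ext i; fin_cases i <;> simp [emb]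
  have hstar : ∀ (c : ℝ) (z : ℤ × ℤ), 1 < c → c • emb z ∈ K → z = 0 := by
    intro c z hc hz
    apply hz0
    have hci : c⁻¹ < 1 := inv_lt_one_of_one_lt₀ hc
    have := hKconv.combo_interior_self_mem_interior h0 hz (a := 1 - c⁻¹) (b := c⁻¹)
      (by linarith) (by positivity) (by ring)
    rwa [smul_zero, zero_add, smul_smul, inv_mul_cancel₀ (by positivity), one_smul] at this
  by_cases hfin : (emb ⁻¹' K).Finite
  swap
  · rw [himg, ncard_image_of_injective _ emb_inj, Set.Infinite.ncard hfin]; norm_num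
  rw [himg, ncard_image_of_injective _ emb_inj, ncard_eq_toFinset_card _ hfin]
  have hmem : ∀ z, z ∈ hfin.toFinset ↔ emb z ∈ K := by intro z; simp
  apply comb
  · intro p hp q hq r hr hD z hz
    rw [hmem] at hp hq hr hz
    by_cases hzz : z = 0
    · subst hzz
      have e0 : emb 0 = 0 := by ext i; fin_cases i <;> simp [emb]
      obtain ⟨a, b, hab, H⟩ := supp_of_not_interior _ (convex_convexHull ℝ (K ∩ latticePts2))
        (hull_interior ⟨hp, emb_mem _⟩ ⟨hq, emb_mem _⟩ ⟨hr, emb_mem _⟩ hD) hP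
      refine ⟨a, b, hab, fun x hx => ?_⟩
      have := H (emb x) (subset_convexHull _ _ ⟨(hmem x).mp hx, emb_mem _⟩)
      simpa [emb] using this
    · obtain ⟨a, b, hab, H⟩ := supp_of_not_interior K hKconv hKint (z := emb z)
        (fun h => hzz (hz0 z h))
      refine ⟨a, b, hab, fun x hx => ?_⟩
      have := H (emb x) ((hmem x).mp hx)
      simpa [emb] using this
  · intro p hp q hq m h1 h2
    rw [hmem] at hp hq ⊢
    have := hKconv hp hq (a := 1 / 2) (b := 1 / 2) (by norm_num) (by norm_num) (by norm_num)
    convert this using 1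
    have c1 : (p.1 : ℝ) + q.1 = 2 * m.1 := by exact_mod_cast h1
    have c2 : (p.2 : ℝ) + q.2 = 2 * m.2 := by exact_mod_cast h2
    ext i; fin_cases i
    · simp [emb]; linarith
    · simp [emb]; linarith
  · intro p hp q hq k u1 u2 hk h1 h2
    rw [hmem] at hp hq
    have c1 : (p.1 : ℝ) - q.1 = k * u1 := by exact_mod_cast h1
    have c2 : (p.2 : ℝ) - q.2 = k * u2 := by exact_mod_cast h2
    have hk' : (4 : ℝ) ≤ k := by exact_mod_cast hk
    have hh := neg_half K hKcpt hKconv hKint hcent hq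
    have := hKconv hp hh (a := 1 / 3) (b := 2 / 3) (by norm_num) (by norm_num) (by norm_num)
    have hz := hstar (k / 3) (u1, u2) (by linarith) (by
      convert this using 1
      ext i; fin_cases i
      · simp [emb]; linarith
      · simp [emb]; linarith)
    exact Prod.mk_eq_zero.mp hz
  · intro p hp m h1 h2
    rw [hmem] at hp
    have hm := hstar 2 m (by norm_num) (by
      convert hp using 1
      ext i; fin_cases i
      · simp [emb, h1]
      · simp [emb, h2])
    subst hm
    ext <;> simp [h1, h2]
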